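/- arXiv:2002.08456 — 2 statements merged into one kernel-verified Lean document; each statement's English description precedes it below -/
import Mathlib

section
/- Let (A^1, A^2, r^1, r^2) be a zero-sum two-player finite normal-form game (r^2 = −r^1), η > 0, and μ̄ an interior strategy profile. Define the policy-dependent transformed payoffs r^i_π(a^i, a^{-i}) = r^i at the action pair − η log(π^i(a^i)/μ̄^i(a^i)) + η log(π^{-i}(a^{-i})/μ̄^{-i}(a^{-i})), with transformed values Ṽ^i(π) = V^i(π) − η·KL(π^i, μ̄^i) + η·KL(π^{-i}, μ̄^{-i}). Let π* be an interior Nash equilibrium of the transformed game, and let t ↦ y_t be differentiable FoReL dynamics: π_t^i = softmax(y_t^i) and d/dt y_t^i(a) = Σ_{a^{-i}} π_t^{-i}(a^{-i}) r^i_{π_t}(a, a^{-i}). Then the sum of Kullback–Leibler divergences Ξ(t) = Σ_{i=1}^2 KL(π*^i, π_t^i) decays exponentially: Ξ(t) ≤ Ξ(0) · exp(−η t) for all t ≥ 0. -/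
open Finset

/-- A probability vector on a finite set: nonnegative entries summing to 1. -/
def IsMixed {α : Type*} [Fintype α] (p : α → ℝ) : Prop :=
  (∀ a, 0 ≤ p a) ∧ ∑ a, p a = 1

/-- A strictly positive (interior) vector. -/
def IsInterior {α : Type*} [Fintype α] (p : α → ℝ) : Prop :=
  ∀ a, 0 < p a

/-- Kullback–Leibler divergence `KL(p, q) = Σ_a p(a) log(p(a)/q(a))`. -/
noncomputable def KL {α : Type*} [Fintype α] (p q : α → ℝ) : ℝ :=
  ∑ a, p a * Real.log (p a / q a)

/-- `softmax(y)(a) = exp(y(a)) / Σ_b exp(y(b))`. -/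
noncomputable def softmax {α : Type*} [Fintype α] (y : α → ℝ) (a : α) : ℝ :=
  Real.exp (y a) / ∑ b, Real.exp (y b)

/-- Expected payoff in a two-player finite normal-form game. -/
noncomputable def val2 {A B : Type*} [Fintype A] [Fintype B]
    (r : A → B → ℝ) (p : A → ℝ) (q : B → ℝ) : ℝ :=
  ∑ a, ∑ b, p a * q b * r a b
theorem softmax_pos {α : Type*} [Fintype α] [Nonempty α] (y : α → ℝ) (a : α) :
    0 < softmax y a :=
  div_pos (Real.exp_pos _) (sum_pos (fun _ _ => Real.exp_pos _) univ_nonempty)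

theorem softmax_isMixed {α : Type*} [Fintype α] [Nonempty α] (y : α → ℝ) :
    IsMixed (softmax y) := by
  refine ⟨fun a => (softmax_pos y a).le, ?_⟩
  have h : (0 : ℝ) < ∑ b, Real.exp (y b) :=
    sum_pos (fun _ _ => Real.exp_pos _) univ_nonempty
  simp only [softmax, ← sum_div]
  exact div_self h.ne'

theorem KL_softmax {α : Type*} [Fintype α] [Nonempty α] {s : α → ℝ} (hs : IsMixed s)
    (hsI : IsInterior s) (y : α → ℝ) :
    KL s (softmax y) =
      ∑ a, s a * Real.log (s a) - ∑ a, s a * y a + Real.log (∑ b, Real.exp (y b)) := by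
  have h : (0 : ℝ) < ∑ b, Real.exp (y b) :=
    sum_pos (fun _ _ => Real.exp_pos _) univ_nonempty
  have key : ∀ a, s a * Real.log (s a / softmax y a) =
      s a * Real.log (s a) - s a * y a + s a * Real.log (∑ b, Real.exp (y b)) := by
    intro a
    rw [Real.log_div (hsI a).ne' (softmax_pos y a).ne', softmax,
      Real.log_div (Real.exp_pos _).ne' h.ne', Real.log_exp]
    ring
  simp only [KL, key, sum_add_distrib, sum_sub_distrib, ← sum_mul, hs.2, one_mul]

theorem hasDerivAt_KL_softmax {α : Type*} [Fintype α] [Nonempty α] {s : α → ℝ}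
    (hs : IsMixed s) (hsI : IsInterior s) {y : ℝ → α → ℝ} {v : α → ℝ} {t : ℝ}
    (hy : ∀ a, HasDerivAt (fun u => y u a) (v a) t) :
    HasDerivAt (fun u => KL s (softmax (y u))) (∑ a, (softmax (y t) a - s a) * v a) t := by
  have h : (0 : ℝ) < ∑ b, Real.exp (y t b) :=
    sum_pos (fun _ _ => Real.exp_pos _) univ_nonempty
  simp_rw [KL_softmax hs hsI]
  have h1 : HasDerivAt (fun u => ∑ a, s a * y u a) (∑ a, s a * v a) t :=
    HasDerivAt.fun_sum fun a _ => (hy a).const_mul (s a)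
  have h2 : HasDerivAt (fun u => ∑ a, Real.exp (y u a)) (∑ a, Real.exp (y t a) * v a) t :=
    HasDerivAt.fun_sum fun a _ => (hy a).exp
  refine ((h1.const_sub _).add (h2.log h.ne')).congr_deriv ?_
  simp only [softmax, sub_mul, sum_sub_distrib, sum_div]
  rw [sub_eq_neg_add]
  congr 1
  exact sum_congr rfl fun a _ => by ring

theorem KL_three_point {α : Type*} [Fintype α] {p s m : α → ℝ} (hp : IsInterior p)
    (hs : IsInterior s) (hm : IsInterior m) :
    ∑ a, (p a - s a) * Real.log (p a / m a) = KL p m - KL s m + KL s p := by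
  simp only [KL, ← sum_sub_distrib, ← sum_add_distrib]
  refine sum_congr rfl fun a _ => ?_
  rw [Real.log_div (hp a).ne' (hm a).ne', Real.log_div (hs a).ne' (hm a).ne',
    Real.log_div (hs a).ne' (hp a).ne']
  ring

theorem sum_sub_mul_expected_transformed_payoff {A B : Type*} [Fintype A] [Fintype B]
    (r : A → B → ℝ) (η : ℝ) {p s : A → ℝ} {q : B → ℝ} (f : A → ℝ) (g : B → ℝ)
    (hp : IsMixed p) (hs : IsMixed s) (hq : IsMixed q) :
    ∑ a, (p a - s a) * ∑ b, q b * (r a b - η * f a + η * g b) =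
      val2 r p q - val2 r s q - η * ∑ a, (p a - s a) * f a := by
  have h : ∀ a, (p a - s a) * ∑ b, q b * (r a b - η * f a + η * g b) =
      ∑ b, p a * q b * r a b - ∑ b, s a * q b * r a b - η * ((p a - s a) * f a)
        + (p a - s a) * (η * ∑ b, q b * g b) := by
    intro a
    have e : ∑ b, q b * (r a b - η * f a + η * g b) =
        ∑ b, q b * r a b - η * f a + η * ∑ b, q b * g b := by
      simp only [mul_add, mul_sub, sum_add_distrib, sum_sub_distrib, mul_left_comm _ η]
      simp only [← mul_sum, ← sum_mul, hq.2, one_mul]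
    rw [e]
    simp only [mul_assoc, ← mul_sum]
    ring
  simp only [h, sum_add_distrib, sum_sub_distrib, ← sum_mul, ← mul_sum, hp.2, hs.2, val2]
  ring

theorem val2_neg_swap {A B : Type*} [Fintype A] [Fintype B]
    (r : A → B → ℝ) (p : A → ℝ) (q : B → ℝ) :
    val2 (fun b a => - r a b) q p = - val2 r p q := by
  simp only [val2, mul_neg, sum_neg_distrib]
  rw [sum_comm]
  simp only [mul_comm (q _) (p _)]

theorem le_mul_exp_of_hasDerivAt_le {f f' : ℝ → ℝ} {c : ℝ}
    (hf : ∀ t, HasDerivAt f (f' t) t) (hle : ∀ t, f' t ≤ - c * f t) {t : ℝ} (ht : 0 ≤ t) :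
    f t ≤ f 0 * Real.exp (- c * t) := by
  have hd : ∀ u, HasDerivAt (fun u => f u * Real.exp (c * u))
      (f' u * Real.exp (c * u) + f u * (Real.exp (c * u) * (c * 1))) u := fun u =>
    (hf u).mul (((hasDerivAt_id u).const_mul c).exp)
  have hanti : Antitone fun u => f u * Real.exp (c * u) :=
    antitone_of_hasDerivAt_nonpos hd fun u => by
      have := mul_nonneg (sub_nonneg.2 (hle u)) (Real.exp_pos (c * u)).le
      rw [Pi.zero_apply]
      linarith
  have h := hanti ht
  simp only [mul_zero, Real.exp_zero, mul_one] at h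
  have hmul := mul_le_mul_of_nonneg_right h (Real.exp_pos (- c * t)).le
  rwa [mul_assoc, ← Real.exp_add, neg_mul, add_neg_cancel, Real.exp_zero, mul_one,
    ← neg_mul] at hmul

/-- For the zero-sum reward transformation
`r^i_π = r^i − η log(π^i/μ̄^i) + η log(π^{-i}/μ̄^{-i})`, the sum of KL divergences
`Ξ(t) = Σ_i KL(π*^i, π_t^i)` between an interior Nash equilibrium `π*` of the
transformed game and the FoReL policies decays exponentially:
`Ξ(t) ≤ Ξ(0)·exp(−η t)`. -/
theorem KL_exponential_decay_zero_sum_transform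
    {A B : Type*} [Fintype A] [Fintype B] [Nonempty A] [Nonempty B]
    (r : A → B → ℝ) (η : ℝ) (hη : 0 < η)
    (m1 : A → ℝ) (m2 : B → ℝ)
    (hm1 : IsMixed m1) (hm1I : IsInterior m1) (hm2 : IsMixed m2) (hm2I : IsInterior m2)
    (s1 : A → ℝ) (s2 : B → ℝ)
    (hs1 : IsMixed s1) (hs1I : IsInterior s1) (hs2 : IsMixed s2) (hs2I : IsInterior s2)
    (hN1 : ∀ p : A → ℝ, IsMixed p →
      val2 r p s2 - η * KL p m1 + η * KL s2 m2 ≤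
        val2 r s1 s2 - η * KL s1 m1 + η * KL s2 m2)
    (hN2 : ∀ q : B → ℝ, IsMixed q →
      (- val2 r s1 q) - η * KL q m2 + η * KL s1 m1 ≤
        (- val2 r s1 s2) - η * KL s2 m2 + η * KL s1 m1)
    (y1 : ℝ → A → ℝ) (y2 : ℝ → B → ℝ)
    (hy1 : ∀ t a, HasDerivAt (fun s => y1 s a)
      (∑ b, softmax (y2 t) b *
        (r a b - η * Real.log (softmax (y1 t) a / m1 a)
          + η * Real.log (softmax (y2 t) b / m2 b))) t)
    (hy2 : ∀ t b, HasDerivAt (fun s => y2 s b)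
      (∑ a, softmax (y1 t) a *
        (- r a b - η * Real.log (softmax (y2 t) b / m2 b)
          + η * Real.log (softmax (y1 t) a / m1 a))) t) :
    ∀ t ≥ (0 : ℝ),
      KL s1 (softmax (y1 t)) + KL s2 (softmax (y2 t)) ≤
        (KL s1 (softmax (y1 0)) + KL s2 (softmax (y2 0))) * Real.exp (- η * t) := by
  intro t ht
  refine le_mul_exp_of_hasDerivAt_le
    (fun u => (hasDerivAt_KL_softmax hs1 hs1I (hy1 u)).add
      (hasDerivAt_KL_softmax hs2 hs2I (hy2 u))) (fun u => ?_) ht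
  have hp := softmax_isMixed (y1 u)
  have hq := softmax_isMixed (y2 u)
  have h1 := sum_sub_mul_expected_transformed_payoff r η
    (fun a => Real.log (softmax (y1 u) a / m1 a))
    (fun b => Real.log (softmax (y2 u) b / m2 b)) hp hs1 hq
  have h2 := sum_sub_mul_expected_transformed_payoff (fun b a => - r a b) η
    (fun b => Real.log (softmax (y2 u) b / m2 b))
    (fun a => Real.log (softmax (y1 u) a / m1 a)) hq hs2 hp
  rw [KL_three_point (softmax_pos (y1 u)) hs1I hm1I] at h1
  rw [KL_three_point (softmax_pos (y2 u)) hs2I hm2I, val2_neg_swap, val2_neg_swap] at h2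
  simp only [Pi.add_apply]
  rw [h1, h2]
  linarith [hN1 _ hp, hN2 _ hq]
end

section
/- Let (A^1, A^2, r^1, r^2) be a zero-sum two-player finite normal-form game (r^2 = −r^1) with policy-independent payoffs admitting an interior Nash equilibrium, and fix base actions a^i_0 ∈ A^i. Let t ↦ w_t be a differentiable solution (for t ≥ 0) of the shifted FoReL system d/dt w_t^i(a) = Q^i_{π_t}(a) − Q^i_{π_t}(a^i_0) with π_t^i = softmax(w_t^i). Then the forward orbit is bounded: there exists C > 0 such that |w_t^i(a)| ≤ C for all t ≥ 0, all players i, and all a ∈ A^i. -/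
open Finset

/-- The Fenchel coupling of the entropy regularizer, up to a constant depending only on `s`. -/
noncomputable def forelPotential {α : Type*} [Fintype α] (s w : α → ℝ) : ℝ :=
  Real.log (∑ a, Real.exp (w a)) - ∑ a, s a * w a

theorem sum_exp_pos {α : Type*} [Fintype α] [Nonempty α] (w : α → ℝ) :
    0 < ∑ a, Real.exp (w a) :=
  Finset.sum_pos (fun a _ => Real.exp_pos (w a)) Finset.univ_nonempty

theorem isMixed_softmax {α : Type*} [Fintype α] [Nonempty α] (w : α → ℝ) :
    IsMixed (softmax w) := by
  refine ⟨fun a => div_nonneg (Real.exp_pos _).le (sum_exp_pos w).le, ?_⟩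
  simp only [softmax]
  rw [← Finset.sum_div, div_self (sum_exp_pos w).ne']

theorem le_log_sum_exp {α : Type*} [Fintype α] (w : α → ℝ) (a : α) :
    w a ≤ Real.log (∑ b, Real.exp (w b)) := by
  have h := Finset.single_le_sum (fun b _ => (Real.exp_pos (w b)).le) (Finset.mem_univ a)
  simpa using Real.log_le_log (Real.exp_pos (w a)) h

theorem forelPotential_eq_sum {α : Type*} [Fintype α] {s : α → ℝ} (hs : IsMixed s)
    (w : α → ℝ) :
    forelPotential s w = ∑ a, s a * (Real.log (∑ b, Real.exp (w b)) - w a) := by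
  simp only [forelPotential, mul_sub, Finset.sum_sub_distrib, ← Finset.sum_mul, hs.2, one_mul]

theorem forelPotential_nonneg {α : Type*} [Fintype α] {s : α → ℝ} (hs : IsMixed s)
    (w : α → ℝ) : 0 ≤ forelPotential s w := by
  rw [forelPotential_eq_sum hs]
  exact Finset.sum_nonneg fun a _ => mul_nonneg (hs.1 a) (sub_nonneg.2 (le_log_sum_exp w a))

theorem mul_sub_le_forelPotential {α : Type*} [Fintype α] {s : α → ℝ} (hs : IsMixed s)
    (w : α → ℝ) (a c : α) : s a * (w c - w a) ≤ forelPotential s w := by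
  rw [forelPotential_eq_sum hs]
  refine (mul_le_mul_of_nonneg_left (sub_le_sub_right (le_log_sum_exp w c) _) (hs.1 a)).trans ?_
  exact Finset.single_le_sum
    (f := fun a => s a * (Real.log (∑ b, Real.exp (w b)) - w a))
    (fun b _ => mul_nonneg (hs.1 b) (sub_nonneg.2 (le_log_sum_exp w b))) (Finset.mem_univ a)

/-- A bound on the potential bounds a weight vector with a pinned coordinate. -/
theorem abs_le_of_forelPotential_le {α : Type*} [Fintype α] {s : α → ℝ} (hs : IsMixed s)
    (hpos : IsInterior s) {w : α → ℝ} {H : ℝ} (hH : forelPotential s w ≤ H) (a₀ a : α) :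
    |w a| ≤ |w a₀| + H * ∑ b, (s b)⁻¹ := by
  have hH0 : 0 ≤ H := (forelPotential_nonneg hs w).trans hH
  have key (b c : α) : w c - w b ≤ H * ∑ b, (s b)⁻¹ := by
    have h1 : w c - w b ≤ H * (s b)⁻¹ := by
      rw [← div_eq_mul_inv, le_div_iff₀ (hpos b), mul_comm]
      exact (mul_sub_le_forelPotential hs w b c).trans hH
    have h2 : (s b)⁻¹ ≤ ∑ b, (s b)⁻¹ :=
      Finset.single_le_sum (f := fun b => (s b)⁻¹) (fun b _ => (inv_pos.2 (hpos b)).le)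
        (Finset.mem_univ b)
    exact h1.trans (mul_le_mul_of_nonneg_left h2 hH0)
  rw [abs_le]
  constructor
  · linarith [key a a₀, neg_abs_le (w a₀)]
  · linarith [key a₀ a, le_abs_self (w a₀)]

theorem hasDerivAt_forelPotential {α : Type*} [Fintype α] [Nonempty α] (s : α → ℝ)
    {w : ℝ → α → ℝ} {w' : α → ℝ} {t : ℝ} (hw : ∀ a, HasDerivAt (fun u => w u a) (w' a) t) :
    HasDerivAt (fun u => forelPotential s (w u))
      (∑ a, softmax (w t) a * w' a - ∑ a, s a * w' a) t := by
  have h1 : HasDerivAt (fun u => ∑ a, Real.exp (w u a)) (∑ a, Real.exp (w t a) * w' a) t :=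
    HasDerivAt.fun_sum fun a _ => (hw a).exp
  have h2 : HasDerivAt (fun u => ∑ a, s a * w u a) (∑ a, s a * w' a) t :=
    HasDerivAt.fun_sum fun a _ => (hw a).const_mul (s a)
  refine ((h1.log (sum_exp_pos (w t)).ne').sub h2).congr_deriv ?_
  congr 1
  simp only [softmax, Finset.sum_div]
  exact Finset.sum_congr rfl fun a _ => by ring

theorem sum_mul_sub_sum_mul_shift {α : Type*} [Fintype α] {p s : α → ℝ} (hp : IsMixed p)
    (hs : IsMixed s) (f : α → ℝ) (c : ℝ) :
    ∑ a, p a * (f a - c) - ∑ a, s a * (f a - c) = ∑ a, p a * f a - ∑ a, s a * f a := by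
  simp only [mul_sub, Finset.sum_sub_distrib, ← Finset.sum_mul, hp.2, hs.2]
  ring

theorem val2_eq_left {A B : Type*} [Fintype A] [Fintype B] (r : A → B → ℝ) (p : A → ℝ)
    (q : B → ℝ) : ∑ a, p a * ∑ b, q b * r a b = val2 r p q := by
  simp only [val2, Finset.mul_sum, mul_assoc]

theorem val2_eq_right {A B : Type*} [Fintype A] [Fintype B] (r : A → B → ℝ) (p : A → ℝ)
    (q : B → ℝ) : ∑ b, q b * ∑ a, p a * r a b = val2 r p q := by
  rw [val2, Finset.sum_comm]
  simp only [Finset.mul_sum]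
  exact Finset.sum_congr rfl fun b _ => Finset.sum_congr rfl fun a _ => by ring

theorem val2_neg {A B : Type*} [Fintype A] [Fintype B] (r : A → B → ℝ) (p : A → ℝ)
    (q : B → ℝ) : val2 (fun a b => - r a b) p q = - val2 r p q := by
  simp only [val2, mul_neg, Finset.sum_neg_distrib]

/-- In a zero-sum two-player game admitting an interior Nash equilibrium, every forward
orbit of the shifted FoReL system
`d/dt w_t^i(a) = Q^i_{π_t}(a) − Q^i_{π_t}(a^i_0)`, `π_t^i = softmax(w_t^i)`, is bounded. -/
theorem shifted_forel_orbit_bounded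
    {A B : Type*} [Fintype A] [Fintype B] [Nonempty A] [Nonempty B]
    (r : A → B → ℝ)
    (hNash : ∃ (s1 : A → ℝ) (s2 : B → ℝ),
      IsMixed s1 ∧ IsInterior s1 ∧ IsMixed s2 ∧ IsInterior s2 ∧
      (∀ p : A → ℝ, IsMixed p → val2 r p s2 ≤ val2 r s1 s2) ∧
      (∀ q : B → ℝ, IsMixed q →
        val2 (fun a b => - r a b) s1 q ≤ val2 (fun a b => - r a b) s1 s2))
    (a0 : A) (b0 : B)
    (w1 : ℝ → A → ℝ) (w2 : ℝ → B → ℝ)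
    (hw1 : ∀ t ≥ (0 : ℝ), ∀ a, HasDerivAt (fun s => w1 s a)
      ((∑ b, softmax (w2 t) b * r a b) - (∑ b, softmax (w2 t) b * r a0 b)) t)
    (hw2 : ∀ t ≥ (0 : ℝ), ∀ b, HasDerivAt (fun s => w2 s b)
      ((∑ a, softmax (w1 t) a * (- r a b)) - (∑ a, softmax (w1 t) a * (- r a b0))) t) :
    ∃ C > (0 : ℝ), ∀ t ≥ (0 : ℝ), (∀ a, |w1 t a| ≤ C) ∧ (∀ b, |w2 t b| ≤ C) := by
  obtain ⟨s1, s2, hs1, hpos1, hs2, hpos2, hN1, hN2⟩ := hNash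
  let F : ℝ → ℝ := fun t => forelPotential s1 (w1 t) + forelPotential s2 (w2 t)
  have hderiv (t : ℝ) (ht : 0 ≤ t) :
      HasDerivAt F (val2 r (softmax (w1 t)) s2 - val2 r s1 (softmax (w2 t))) t := by
    refine ((hasDerivAt_forelPotential s1 (hw1 t ht)).add
      (hasDerivAt_forelPotential s2 (hw2 t ht))).congr_deriv ?_
    rw [sum_mul_sub_sum_mul_shift (isMixed_softmax _) hs1,
      sum_mul_sub_sum_mul_shift (isMixed_softmax _) hs2,
      val2_eq_left, val2_eq_left, val2_eq_right (fun a b => - r a b),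
      val2_eq_right (fun a b => - r a b), val2_neg, val2_neg]
    ring
  have hanti : AntitoneOn F (Set.Ici 0) := by
    refine antitoneOn_of_hasDerivWithinAt_nonpos (convex_Ici 0)
      (fun t ht => (hderiv t ht).continuousAt.continuousWithinAt)
      (fun t ht => (hderiv t (interior_subset ht)).hasDerivWithinAt) fun t _ => ?_
    have h1 := hN1 _ (isMixed_softmax (w1 t))
    have h2 := hN2 _ (isMixed_softmax (w2 t))
    rw [val2_neg, val2_neg] at h2
    linarith
  have hconst {f : ℝ → ℝ} (hf : ∀ t ≥ (0 : ℝ), HasDerivAt f 0 t) (t : ℝ) (ht : 0 ≤ t) :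
      f t = f 0 :=
    constant_of_has_deriv_right_zero
      (fun x hx => (hf x hx.1).continuousAt.continuousWithinAt)
      (fun x hx => (hf x hx.1).hasDerivWithinAt) t ⟨ht, le_rfl⟩
  have hbase1 := hconst (f := fun t => w1 t a0) fun t ht => by simpa using hw1 t ht a0
  have hbase2 := hconst (f := fun t => w2 t b0) fun t ht => by simpa using hw2 t ht b0
  have hF0 : 0 ≤ F 0 :=
    add_nonneg (forelPotential_nonneg hs1 _) (forelPotential_nonneg hs2 _)
  have hsum1 : 0 ≤ F 0 * ∑ a, (s1 a)⁻¹ :=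
    mul_nonneg hF0 (Finset.sum_nonneg fun a _ => (inv_pos.2 (hpos1 a)).le)
  have hsum2 : 0 ≤ F 0 * ∑ b, (s2 b)⁻¹ :=
    mul_nonneg hF0 (Finset.sum_nonneg fun b _ => (inv_pos.2 (hpos2 b)).le)
  refine ⟨(|w1 0 a0| + F 0 * ∑ a, (s1 a)⁻¹) + (|w2 0 b0| + F 0 * ∑ b, (s2 b)⁻¹) + 1,
    by positivity, fun t ht => ?_⟩
  have hFt : forelPotential s1 (w1 t) + forelPotential s2 (w2 t) ≤ F 0 :=
    hanti Set.self_mem_Ici ht ht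
  have hp1 := forelPotential_nonneg hs1 (w1 t)
  have hp2 := forelPotential_nonneg hs2 (w2 t)
  constructor
  · intro a
    have h := abs_le_of_forelPotential_le hs1 hpos1 (w := w1 t) (H := F 0) (by linarith) a0 a
    rw [hbase1 t ht] at h
    linarith [abs_nonneg (w2 0 b0)]
  · intro b
    have h := abs_le_of_forelPotential_le hs2 hpos2 (w := w2 t) (H := F 0) (by linarith) b0 b
    rw [hbase2 t ht] at h
    linarith [abs_nonneg (w1 0 a0)]
end
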